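/- Let Q be a cube in ℝ^n with sides parallel to the axes. Then 𝓜_{A₁}(Q) = 𝓜_{A_∞}(Q); that is, a measurable function on Q has an A₁(Q) majorant if and only if it has an A_∞(Q) majorant. -/

import Mathlib

open MeasureTheory ENNReal

/-- A (nondegenerate) cube in `ℝⁿ` with sides parallel to the axes. -/
def IsCube {n : ℕ} (Q : Set (Fin n → ℝ)) : Prop :=
  ∃ (a : Fin n → ℝ) (l : ℝ), 0 < l ∧
    Q = Set.univ.pi fun i => Set.Icc (a i) (a i + l)

/-- The domains considered: all of `ℝⁿ` or a cube with sides parallel to the axes. -/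
def IsAdmissibleDomain {n : ℕ} (Ω : Set (Fin n → ℝ)) : Prop :=
  Ω = Set.univ ∨ IsCube Ω

/-- The Hardy–Littlewood maximal operator restricted to `Ω`:
`M_Ω f (x) = sup { (1/|Q|) ∫_Q |f| : Q ⊆ Ω a cube with x ∈ Q }`. -/
noncomputable def maximal {n : ℕ} (Ω : Set (Fin n → ℝ)) (f : (Fin n → ℝ) → ℝ)
    (x : Fin n → ℝ) : ℝ≥0∞ :=
  ⨆ (Q : Set (Fin n → ℝ)) (_ : IsCube Q) (_ : Q ⊆ Ω) (_ : x ∈ Q),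
    (volume Q)⁻¹ * ∫⁻ y in Q, ENNReal.ofReal |f y|

/-- A weight on `Ω`: a measurable function, positive a.e. on `Ω`, integrable on every
cube contained in `Ω` (hence locally integrable; integrable when `Ω` is itself a cube). -/
structure IsWeight {n : ℕ} (Ω : Set (Fin n → ℝ)) (w : (Fin n → ℝ) → ℝ) : Prop where
  measurable : Measurable w
  pos : ∀ᵐ x ∂(volume.restrict Ω), 0 < w x
  locInt : ∀ Q : Set (Fin n → ℝ), IsCube Q → Q ⊆ Ω → IntegrableOn w Q

/-- The Muckenhoupt `A₁(Ω)` class: `M_Ω w ≤ C w` a.e. on `Ω`. -/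
def MemA1 {n : ℕ} (Ω : Set (Fin n → ℝ)) (w : (Fin n → ℝ) → ℝ) : Prop :=
  IsWeight Ω w ∧ ∃ C : ℝ, ∀ᵐ x ∂(volume.restrict Ω),
    maximal Ω w x ≤ ENNReal.ofReal (C * w x)

/-- The Muckenhoupt `A_p(Ω)` class for `1 < p < ∞`:
`sup_{Q ⊆ Ω} (avg_Q w) * (avg_Q w^(1-p'))^(p-1) < ∞` where `p' = p/(p-1)`. -/
def MemApGT1 {n : ℕ} (Ω : Set (Fin n → ℝ)) (p : ℝ) (w : (Fin n → ℝ) → ℝ) : Prop :=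
  IsWeight Ω w ∧ ∃ C : ℝ≥0∞, C ≠ ∞ ∧ ∀ Q : Set (Fin n → ℝ), IsCube Q → Q ⊆ Ω →
    ((volume Q)⁻¹ * ∫⁻ x in Q, ENNReal.ofReal (w x)) *
      ((volume Q)⁻¹ * ∫⁻ x in Q, ENNReal.ofReal (w x ^ (1 - p / (p - 1)))) ^ (p - 1) ≤ C

/-- The Muckenhoupt `A_p(Ω)` class for `1 ≤ p < ∞`. -/
def MemA {n : ℕ} (Ω : Set (Fin n → ℝ)) (p : ℝ) (w : (Fin n → ℝ) → ℝ) : Prop :=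
  (p = 1 ∧ MemA1 Ω w) ∨ (1 < p ∧ MemApGT1 Ω p w)

/-- The Muckenhoupt `A_∞(Ω)` class: the union of `A_p(Ω)` over `1 ≤ p < ∞`. -/
def MemAInf {n : ℕ} (Ω : Set (Fin n → ℝ)) (w : (Fin n → ℝ) → ℝ) : Prop :=
  ∃ p : ℝ, 1 ≤ p ∧ MemA Ω p w

/-- Membership in the weighted Lebesgue space `L^p_w(Ω)`: `f` measurable with
`∫_Ω |f|^p w < ∞`. -/
def MemLw {n : ℕ} (Ω : Set (Fin n → ℝ)) (p : ℝ) (w f : (Fin n → ℝ) → ℝ) : Prop :=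
  Measurable f ∧
    ∫⁻ x in Ω, ENNReal.ofReal |f x| ^ p * ENNReal.ofReal (w x) < ⊤

/-- Membership in the (unweighted) Lebesgue space `L^p(Ω)`. -/
def MemLeb {n : ℕ} (Ω : Set (Fin n → ℝ)) (p : ℝ) (f : (Fin n → ℝ) → ℝ) : Prop :=
  MemLw Ω p (fun _ => 1) f

/-- `f ∈ 𝓜_{A_p}(Ω)`: `f` is measurable and `|f| ≤ w` a.e. on `Ω` for some `w ∈ A_p(Ω)`. -/
def HasApMajorant {n : ℕ} (Ω : Set (Fin n → ℝ)) (p : ℝ) (f : (Fin n → ℝ) → ℝ) : Prop :=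
  Measurable f ∧ ∃ w, MemA Ω p w ∧ ∀ᵐ x ∂(volume.restrict Ω), |f x| ≤ w x

/-- `f ∈ 𝓜^r_{A_p}(Ω)`: `f` is measurable and `|f|^r ≤ w` a.e. on `Ω` for some
`w ∈ A_p(Ω)`. -/
def HasApPowMajorant {n : ℕ} (Ω : Set (Fin n → ℝ)) (p r : ℝ) (f : (Fin n → ℝ) → ℝ) : Prop :=
  Measurable f ∧ ∃ w, MemA Ω p w ∧ ∀ᵐ x ∂(volume.restrict Ω), |f x| ^ r ≤ w x

/-- `f ∈ 𝓜_{A_∞}(Ω)`: `f` is measurable and `|f| ≤ w` a.e. on `Ω` for some `w ∈ A_∞(Ω)`. -/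
def HasAInfMajorant {n : ℕ} (Ω : Set (Fin n → ℝ)) (f : (Fin n → ℝ) → ℝ) : Prop :=
  Measurable f ∧ ∃ w, MemAInf Ω w ∧ ∀ᵐ x ∂(volume.restrict Ω), |f x| ≤ w x

/-- Membership in weak `L^p(ℝⁿ)`: `sup_{t>0} t · |{|f| > t}|^{1/p} < ∞`. -/
def MemWeakLp {n : ℕ} (p : ℝ) (f : (Fin n → ℝ) → ℝ) : Prop :=
  Measurable f ∧ ∃ C : ℝ≥0∞, C ≠ ⊤ ∧ ∀ t : ℝ, 0 < t →
    ENNReal.ofReal t * volume {x | t < |f x|} ^ (1 / p) ≤ C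

lemma IsCube.volume_ne_zero {n : ℕ} {Q : Set (Fin n → ℝ)} (hQ : IsCube Q) : volume Q ≠ 0 := by
  obtain ⟨a, l, hl, rfl⟩ := hQ
  rw [volume_pi_pi]
  simp [hl]

lemma IsCube.volume_ne_top {n : ℕ} {Q : Set (Fin n → ℝ)} (hQ : IsCube Q) : volume Q ≠ ∞ := by
  obtain ⟨a, l, hl, rfl⟩ := hQ
  rw [volume_pi_pi]
  simp

lemma IsCube.measurableSet {n : ℕ} {Q : Set (Fin n → ℝ)} (hQ : IsCube Q) : MeasurableSet Q := by
  obtain ⟨a, l, hl, rfl⟩ := hQ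
  exact MeasurableSet.univ_pi fun _ => measurableSet_Icc

/-- Hölder's inequality for the dual pair `w`, `w ^ (1 - p')`. -/
lemma measure_rpow_le_lintegral_mul_lintegral_dual {X : Type*} [MeasurableSpace X] {μ : Measure X}
    {p : ℝ} (hp : 1 < p) {w : X → ℝ} (hw : Measurable w) {F : Set X}
    (hpos : ∀ᵐ x ∂μ.restrict F, 0 < w x) :
    μ F ^ p ≤ (∫⁻ x in F, ENNReal.ofReal (w x) ∂μ) *
      (∫⁻ x in F, ENNReal.ofReal (w x ^ (1 - p / (p - 1))) ∂μ) ^ (p - 1) := by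
  have hp0 : 0 < p := by linarith
  have hp1 : 0 < p - 1 := by linarith
  have hpq : p.HolderConjugate (p / (p - 1)) := Real.HolderConjugate.conjExponent hp
  have h := ENNReal.lintegral_mul_le_Lp_mul_Lq (μ.restrict F) hpq
    (f := fun x => ENNReal.ofReal (w x) ^ (1 / p))
    (g := fun x => ENNReal.ofReal (w x) ^ (-(1 / p)))
    (by fun_prop) (by fun_prop)
  have h1 : ∫⁻ x in F, ((fun x => ENNReal.ofReal (w x) ^ (1 / p)) *
      fun x => ENNReal.ofReal (w x) ^ (-(1 / p))) x ∂μ = μ F := by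
    rw [← setLIntegral_one]
    refine lintegral_congr_ae ?_
    filter_upwards [hpos] with x hx
    have hx' : ENNReal.ofReal (w x) ≠ 0 := by simpa using hx
    simp only [Pi.mul_apply]
    rw [← ENNReal.rpow_add _ _ hx' ENNReal.ofReal_ne_top]
    simp
  have h2 : ∫⁻ x in F, (ENNReal.ofReal (w x) ^ (1 / p)) ^ p ∂μ =
      ∫⁻ x in F, ENNReal.ofReal (w x) ∂μ := by
    refine lintegral_congr fun x => ?_
    rw [← ENNReal.rpow_mul, one_div_mul_cancel hp0.ne', ENNReal.rpow_one]
  have h3 : ∫⁻ x in F, (ENNReal.ofReal (w x) ^ (-(1 / p))) ^ (p / (p - 1)) ∂μ =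
      ∫⁻ x in F, ENNReal.ofReal (w x ^ (1 - p / (p - 1))) ∂μ := by
    refine lintegral_congr_ae ?_
    filter_upwards [hpos] with x hx
    rw [← ENNReal.rpow_mul, ENNReal.ofReal_rpow_of_pos hx]
    congr 2
    field_simp
    ring
  rw [h1, h2, h3] at h
  calc μ F ^ p ≤ _ := ENNReal.rpow_le_rpow h hp0.le
    _ = _ := by
      rw [ENNReal.mul_rpow_of_nonneg _ _ hp0.le, ← ENNReal.rpow_mul, ← ENNReal.rpow_mul,
        one_div_mul_cancel hp0.ne', ENNReal.rpow_one]
      congr 2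
      field_simp

/-- An `A_p` weight gives a subset of at most half of a cube at most a fixed proportion `β < 1` of
the weight of the cube. -/
lemma MemApGT1.exists_setLIntegral_le {n : ℕ} {Q : Set (Fin n → ℝ)} {p : ℝ} (hp : 1 < p)
    {w : (Fin n → ℝ) → ℝ} (hw : MemApGT1 Q p w) :
    ∃ β : ℝ≥0∞, β < 1 ∧ ∀ Q' : Set (Fin n → ℝ), IsCube Q' → Q' ⊆ Q →
      ∀ E ⊆ Q', MeasurableSet E → 2 * volume E ≤ volume Q' →
        ∫⁻ x in E, ENNReal.ofReal (w x) ≤ β * ∫⁻ x in Q', ENNReal.ofReal (w x) := by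
  obtain ⟨⟨hwm, hpos, hint⟩, C, hC, hA⟩ := hw
  have hp0 : 0 < p := by linarith
  have hp1 : 0 < p - 1 := by linarith
  set K : ℝ≥0∞ := 2 ^ p * C + 1 with hK
  have hKtop : K ≠ ∞ := by
    simp only [hK, ne_eq, ENNReal.add_eq_top, ENNReal.one_ne_top, or_false]
    exact ENNReal.mul_ne_top (ENNReal.rpow_ne_top_of_nonneg hp0.le (by simp)) hC
  have hK0 : K ≠ 0 := by simp [hK]
  refine ⟨1 - K⁻¹, ENNReal.sub_lt_self (by simp) (by simp) (by simpa using hKtop), ?_⟩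
  intro Q' hQ' hsub E hE hEm hE2
  set F := Q' \ E with hF
  set V := volume Q'
  set W := ∫⁻ x in Q', ENNReal.ofReal (w x)
  set S := ∫⁻ x in Q', ENNReal.ofReal (w x ^ (1 - p / (p - 1)))
  have hV0 : V ≠ 0 := hQ'.volume_ne_zero
  have hVt : V ≠ ∞ := hQ'.volume_ne_top
  have hWt : W ≠ ∞ := (hint Q' hQ' hsub).lintegral_lt_top.ne
  have hFm : MeasurableSet F := hQ'.measurableSet.diff hEm
  have hVF : V ≤ 2 * volume F := by
    have h1 : volume E + volume F = V := by
      have := measure_inter_add_sdiff (μ := volume) Q' hEm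
      rwa [Set.inter_eq_right.2 hE] at this
    have hEt : volume E ≠ ∞ := ne_top_of_le_ne_top hVt (measure_mono hE)
    have h2 : volume E ≤ volume F := by
      refine ENNReal.le_of_add_le_add_left hEt ?_
      rw [h1, ← two_mul]; exact hE2
    rw [← h1, two_mul]; gcongr
  have hsplit : (∫⁻ x in E, ENNReal.ofReal (w x)) + ∫⁻ x in F, ENNReal.ofReal (w x) = W := by
    have := lintegral_inter_add_sdiff (μ := volume) (fun x => ENNReal.ofReal (w x)) Q' hEm
    rwa [Set.inter_eq_right.2 hE] at this
  have hposF : ∀ᵐ x ∂volume.restrict F, 0 < w x :=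
    ae_restrict_of_ae_restrict_of_subset (Set.sdiff_subset.trans hsub) hpos
  have hH := measure_rpow_le_lintegral_mul_lintegral_dual (μ := volume) hp hwm hposF
  have hAp : W * S ^ (p - 1) ≤ C * V ^ p := by
    have h := hA Q' hQ' hsub
    have hVp : V ^ p = V * V ^ (p - 1) := by
      nth_rewrite 2 [← ENNReal.rpow_one V]
      rw [← ENNReal.rpow_add _ _ hV0 hVt]; congr 1; ring
    have hV1 : V ^ (p - 1) ≠ 0 := by simp [ENNReal.rpow_eq_zero_iff, hV0, hVt]
    have hV2 : V ^ (p - 1) ≠ ∞ := ENNReal.rpow_ne_top_of_nonneg hp1.le hVt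
    calc W * S ^ (p - 1) = (V⁻¹ * W * (V⁻¹ * S) ^ (p - 1)) * V ^ p := by
          rw [hVp, ENNReal.mul_rpow_of_nonneg _ _ hp1.le, ENNReal.inv_rpow]
          calc W * S ^ (p - 1) = (V⁻¹ * V) * ((V ^ (p - 1))⁻¹ * V ^ (p - 1)) * (W * S ^ (p - 1)) := by
                rw [ENNReal.inv_mul_cancel hV0 hVt, ENNReal.inv_mul_cancel hV1 hV2]; simp
            _ = _ := by ring
      _ ≤ C * V ^ p := by gcongr
  have hVp0 : V ^ p ≠ 0 := by simp [ENNReal.rpow_eq_zero_iff, hV0, hVt]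
  have hVpt : V ^ p ≠ ∞ := ENNReal.rpow_ne_top_of_nonneg hp0.le hVt
  have hWF : W ≤ K * ∫⁻ x in F, ENNReal.ofReal (w x) := by
    refine le_trans ?_ (mul_le_mul_left (le_self_add : 2 ^ p * C ≤ K) _)
    rw [← ENNReal.mul_le_mul_iff_right hVp0 hVpt]
    calc V ^ p * W ≤ (2 * volume F) ^ p * W := by gcongr
      _ = 2 ^ p * volume F ^ p * W := by rw [ENNReal.mul_rpow_of_nonneg _ _ hp0.le]
      _ ≤ 2 ^ p * ((∫⁻ x in F, ENNReal.ofReal (w x)) * S ^ (p - 1)) * W := by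
        gcongr
        refine hH.trans ?_
        exact mul_le_mul_right (ENNReal.rpow_le_rpow
          (lintegral_mono_set Set.sdiff_subset) hp1.le) _
      _ = 2 ^ p * (∫⁻ x in F, ENNReal.ofReal (w x)) * (W * S ^ (p - 1)) := by ring
      _ ≤ 2 ^ p * (∫⁻ x in F, ENNReal.ofReal (w x)) * (C * V ^ p) := by gcongr
      _ = _ := by ring
  have hFt : ∫⁻ x in F, ENNReal.ofReal (w x) ≠ ∞ :=
    ne_top_of_le_ne_top hWt (hsplit ▸ le_add_self)
  rw [ENNReal.sub_mul (fun _ _ => hWt), one_mul, ENNReal.eq_sub_of_add_eq hFt hsplit]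
  gcongr
  exact ENNReal.inv_mul_le_iff hK0 hKtop |>.2 hWF

/-- Layer-cake bound: if the distribution function of `F` decays like `β ^ j` at the levels
`Λ ^ j * t`, then small powers of `F` are integrable. -/
lemma lintegral_rpow_le_of_measure_pow_lt_le {X : Type*} [MeasurableSpace X] {ρ : Measure X}
    {F : X → ℝ≥0∞} (hF : Measurable F) {ε : ℝ} (hε : 0 < ε) {Λ β t M : ℝ≥0∞} (hΛ : 1 < Λ)
    (hΛt : Λ ≠ ∞) (ht0 : t ≠ 0) (htt : t ≠ ∞) (huniv : ρ Set.univ ≤ M)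
    (h : ∀ j : ℕ, ρ {x | Λ ^ j * t < F x} ≤ β ^ j * M) :
    ∫⁻ x, F x ^ ε ∂ρ ≤ (1 + Λ ^ ε * (1 - Λ ^ ε * β)⁻¹) * t ^ ε * M := by
  have hmeas : ∀ j : ℕ, MeasurableSet {x | Λ ^ j * t < F x} := fun j =>
    measurableSet_lt measurable_const hF
  have hpt : ∀ x, F x ^ ε ≤ t ^ ε +
      ∑' j : ℕ, {x | Λ ^ j * t < F x}.indicator (fun _ => (Λ ^ (j + 1) * t) ^ ε) x := by
    intro x
    by_cases hx : F x ≤ t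
    · exact (ENNReal.rpow_le_rpow hx hε.le).trans le_self_add
    by_cases hxt : F x = ∞
    · have : (∑' j : ℕ, {x | Λ ^ j * t < F x}.indicator (fun _ => (Λ ^ (j + 1) * t) ^ ε) x)
          = ∞ := by
        rw [← top_le_iff, ← ENNReal.tsum_const_eq_top_of_ne_zero (α := ℕ) (c := t ^ ε)
          (by simp [ENNReal.rpow_eq_zero_iff, ht0, htt])]
        refine ENNReal.tsum_le_tsum fun j => ?_
        rw [Set.indicator_of_mem]
        · refine ENNReal.rpow_le_rpow ?_ hε.le
          exact le_mul_of_one_le_left' (one_le_pow_of_one_le' hΛ.le _)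
        · simp only [Set.mem_ofPred_eq, hxt]
          exact ENNReal.mul_lt_top (ENNReal.pow_lt_top hΛt.lt_top) htt.lt_top
      rw [this]; simp
    · have hex : ∃ j : ℕ, F x ≤ Λ ^ j * t := by
        have h1 : Filter.Tendsto (fun j : ℕ => Λ ^ j * t) Filter.atTop (nhds (∞ * t)) :=
          ENNReal.Tendsto.mul_const (ENNReal.tendsto_pow_atTop_nhds_top_iff.2 hΛ) (by simp)
        rw [ENNReal.top_mul ht0] at h1
        obtain ⟨j, hj⟩ := (h1.eventually (lt_mem_nhds (Ne.lt_top hxt))).exists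
        exact ⟨j, hj.le⟩
      classical
      have hj := Nat.find_spec hex
      obtain ⟨i, hi⟩ : ∃ i, Nat.find hex = i + 1 := by
        refine Nat.exists_eq_succ_of_ne_zero fun h0 => hx ?_
        simpa [h0] using hj
      have hi' : Λ ^ i * t < F x := not_le.1 (Nat.find_min hex (by omega))
      rw [hi] at hj
      refine le_add_left (le_trans ?_ (ENNReal.le_tsum i))
      rw [Set.indicator_of_mem (by exact hi')]
      exact ENNReal.rpow_le_rpow hj hε.le
  calc ∫⁻ x, F x ^ ε ∂ρ ≤ ∫⁻ x, (t ^ ε +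
      ∑' j : ℕ, {x | Λ ^ j * t < F x}.indicator (fun _ => (Λ ^ (j + 1) * t) ^ ε) x) ∂ρ :=
        lintegral_mono hpt
    _ = t ^ ε * ρ Set.univ + ∑' j : ℕ, (Λ ^ (j + 1) * t) ^ ε * ρ {x | Λ ^ j * t < F x} := by
        rw [lintegral_add_left measurable_const, lintegral_const, lintegral_tsum]
        · congr 2
          ext j
          rw [lintegral_indicator_const (hmeas j)]
        · exact fun j => (measurable_const.indicator (hmeas j)).aemeasurable
    _ ≤ t ^ ε * M + ∑' j : ℕ, (Λ ^ (j + 1) * t) ^ ε * (β ^ j * M) := by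
        gcongr with j
        exact h j
    _ = t ^ ε * M + ∑' j : ℕ, (Λ ^ ε * t ^ ε * M) * (Λ ^ ε * β) ^ j := by
        congr 2
        ext j
        rw [ENNReal.mul_rpow_of_nonneg _ _ hε.le, ← ENNReal.rpow_natCast, ← ENNReal.rpow_mul,
          mul_comm _ ε, ENNReal.rpow_mul, ENNReal.rpow_natCast]
        ring
    _ = _ := by
        rw [ENNReal.tsum_mul_left, ENNReal.tsum_geometric]
        ring

/-- Two measures that compare on each block of a countable partition of `Ω` compare on `Ω`. -/
lemma measure_inter_le_of_partition {X : Type*} [MeasurableSpace X] {μ ν : Measure X}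
    {Ω A B : Set X} {S : X → Set X} (hmem : ∀ x ∈ Ω, x ∈ S x) (hsub : ∀ x ∈ Ω, S x ⊆ Ω)
    (hmeas : ∀ x ∈ Ω, MeasurableSet (S x)) (hcount : (S '' Ω).Countable)
    (heq : ∀ x ∈ Ω, ∀ y ∈ S x, S y = S x) (hA : MeasurableSet A) (hB : MeasurableSet B)
    (h : ∀ x ∈ Ω, μ (A ∩ S x) ≤ ν (B ∩ S x)) : μ (A ∩ Ω) ≤ ν (B ∩ Ω) := by
  have hΩ : Ω = ⋃ s ∈ S '' Ω, s := by
    refine Set.Subset.antisymm (fun x hx => ?_) ?_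
    · exact Set.mem_biUnion (Set.mem_image_of_mem S hx) (hmem x hx)
    · simpa using hsub
  have hdisj : (S '' Ω).PairwiseDisjoint id := by
    rintro _ ⟨x, hx, rfl⟩ _ ⟨y, hy, rfl⟩ hne
    refine Set.disjoint_left.2 fun z hzx hzy => hne ?_
    rw [← heq x hx z hzx, heq y hy z hzy]
  have key : ∀ (m : Measure X) (E : Set X), MeasurableSet E →
      m (E ∩ Ω) = ∑' s : S '' Ω, m (E ∩ s) := by
    intro m E hE
    conv_lhs => rw [hΩ, Set.inter_iUnion₂]
    refine measure_biUnion hcount (fun s hs t ht hst => ?_) ?_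
    · exact (hdisj hs ht hst).mono Set.inter_subset_right Set.inter_subset_right
    · rintro _ ⟨x, hx, rfl⟩
      exact hE.inter (hmeas x hx)
  rw [key μ A hA, key ν B hB]
  refine ENNReal.tsum_le_tsum ?_
  rintro ⟨_, x, hx, rfl⟩
  exact h x hx

/-- A nested sequence of countable measurable partitions; `D k x` is the block of generation `k`
containing `x`. -/
structure IsNestedPartition {X : Type*} [MeasurableSpace X] (D : ℕ → X → Set X) : Prop where
  mem_self : ∀ k x, x ∈ D k x
  eq_of_mem : ∀ k x, ∀ y ∈ D k x, D k y = D k x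
  succ_subset : ∀ k x, D (k + 1) x ⊆ D k x
  measurableSet : ∀ k x, MeasurableSet (D k x)
  countable : ∀ k, (Set.range (D k)).Countable

/-- The points of `Q₀` lying in some block of `D` on which the average of `ν` exceeds `t`. -/
def superlevelSet {X : Type*} [MeasurableSpace X] (μ ν : Measure X) (D : ℕ → X → Set X)
    (Q₀ : Set X) (t : ℝ≥0∞) : Set X :=
  {x | x ∈ Q₀ ∧ ∃ k, t * μ (D k x) < ν (D k x)}

/-- The first generation at which the average of `ν` around `x` exceeds `t`. -/
noncomputable def stoppingTime {X : Type*} [MeasurableSpace X] (μ ν : Measure X)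
    (D : ℕ → X → Set X) (t : ℝ≥0∞) (x : X) : ℕ :=
  sInf {k | t * μ (D k x) < ν (D k x)}

namespace IsNestedPartition

variable {X : Type*} [MeasurableSpace X] {μ ν : Measure X} {D : ℕ → X → Set X}

lemma antitone (hD : IsNestedPartition D) (x : X) : Antitone fun k => D k x :=
  antitone_nat_of_succ_le fun k => hD.succ_subset k x

lemma eq_of_mem_of_le (hD : IsNestedPartition D) {i j : ℕ} (hij : i ≤ j) {x y : X}
    (hy : y ∈ D j x) : D i y = D i x :=
  hD.eq_of_mem i x y (hD.antitone x hij hy)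

lemma lt_stoppingTime {Q₀ : Set X} {t : ℝ≥0∞} {x : X} (hx : x ∈ superlevelSet μ ν D Q₀ t) :
    t * μ (D (stoppingTime μ ν D t x) x) < ν (D (stoppingTime μ ν D t x) x) :=
  Nat.sInf_mem (s := {k | t * μ (D k x) < ν (D k x)}) hx.2

lemma stoppingTime_eq_of_mem (hD : IsNestedPartition D) {Q₀ : Set X} {t : ℝ≥0∞} {x y : X}
    (hx : x ∈ superlevelSet μ ν D Q₀ t) (hy : y ∈ D (stoppingTime μ ν D t x) x) :
    stoppingTime μ ν D t y = stoppingTime μ ν D t x := by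
  have h1 : stoppingTime μ ν D t y ≤ stoppingTime μ ν D t x := by
    refine Nat.sInf_le ?_
    change t * μ (D _ y) < ν (D _ y)
    rw [hD.eq_of_mem_of_le le_rfl hy]
    exact lt_stoppingTime hx
  refine le_antisymm h1 (Nat.sInf_le ?_)
  have h2 : t * μ (D (stoppingTime μ ν D t y) y) < ν (D (stoppingTime μ ν D t y) y) := by
    refine Nat.sInf_mem (s := {k | t * μ (D k y) < ν (D k y)}) ⟨stoppingTime μ ν D t x, ?_⟩
    change t * μ (D _ y) < ν (D _ y)
    rw [hD.eq_of_mem_of_le le_rfl hy]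
    exact lt_stoppingTime hx
  rw [hD.eq_of_mem_of_le h1 hy] at h2
  exact h2

lemma stoppingBlock_subset (hD : IsNestedPartition D) {x₀ : X} {t : ℝ≥0∞} {x : X}
    (hx : x ∈ superlevelSet μ ν D (D 0 x₀) t) :
    D (stoppingTime μ ν D t x) x ⊆ superlevelSet μ ν D (D 0 x₀) t := by
  intro y hy
  refine ⟨?_, stoppingTime μ ν D t x, ?_⟩
  · rw [← hD.eq_of_mem 0 x₀ x hx.1]
    exact hD.antitone x (Nat.zero_le _) hy
  · rw [hD.eq_of_mem_of_le le_rfl hy]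
    exact lt_stoppingTime hx

lemma countable_stoppingBlocks (hD : IsNestedPartition D) (t : ℝ≥0∞) (Ω : Set X) :
    ((fun x => D (stoppingTime μ ν D t x) x) '' Ω).Countable := by
  refine (Set.countable_iUnion hD.countable).mono ?_
  rintro _ ⟨x, -, rfl⟩
  exact Set.mem_iUnion.2 ⟨_, x, rfl⟩

lemma measurableSet_superlevelSet (hD : IsNestedPartition D) (x₀ : X) (t : ℝ≥0∞) :
    MeasurableSet (superlevelSet μ ν D (D 0 x₀) t) := by
  have h : superlevelSet μ ν D (D 0 x₀) t =
      ⋃₀ ((fun x => D (stoppingTime μ ν D t x) x) '' superlevelSet μ ν D (D 0 x₀) t) := by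
    refine Set.Subset.antisymm (fun x hx => ?_) ?_
    · exact ⟨_, Set.mem_image_of_mem _ hx, hD.mem_self _ _⟩
    · rintro y ⟨_, ⟨x, hx, rfl⟩, hy⟩
      exact hD.stoppingBlock_subset hx hy
  rw [h]
  refine MeasurableSet.sUnion (hD.countable_stoppingBlocks t _) ?_
  rintro _ ⟨x, -, rfl⟩
  exact hD.measurableSet _ _

lemma measure_inter_superlevelSet_le (hD : IsNestedPartition D) {μ' ν' : Measure X} {x₀ : X}
    {t : ℝ≥0∞} {A B : Set X} (hA : MeasurableSet A) (hB : MeasurableSet B)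
    (h : ∀ x ∈ superlevelSet μ ν D (D 0 x₀) t,
      μ' (A ∩ D (stoppingTime μ ν D t x) x) ≤ ν' (B ∩ D (stoppingTime μ ν D t x) x)) :
    μ' (A ∩ superlevelSet μ ν D (D 0 x₀) t) ≤ ν' (B ∩ superlevelSet μ ν D (D 0 x₀) t) :=
  measure_inter_le_of_partition (fun _ _ => hD.mem_self _ _)
    (fun _ hx => hD.stoppingBlock_subset hx) (fun _ _ => hD.measurableSet _ _)
    (hD.countable_stoppingBlocks t _)
    (fun x hx y hy => by
      rw [hD.stoppingTime_eq_of_mem hx hy]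
      exact hD.eq_of_mem_of_le le_rfl hy) hA hB h

/-- One step of the good-`λ` iteration: passing from level `t` to level `2 * K * t` decreases the
`ν`-measure of the superlevel set by the factor `β`. -/
lemma measure_superlevelSet_mul_le (hD : IsNestedPartition D) {x₀ : X} {t K β : ℝ≥0∞}
    (ht0 : t ≠ 0) (htt : t ≠ ∞) (hK1 : 1 ≤ K) (hKt : K ≠ ∞)
    (htop : ν (D 0 x₀) ≤ t * μ (D 0 x₀))
    (hdoubling : ∀ k, ∀ x ∈ D 0 x₀, μ (D k x) ≤ K * μ (D (k + 1) x))
    (hβ : ∀ k, ∀ x ∈ D 0 x₀, ∀ E ⊆ D k x, MeasurableSet E → 2 * μ E ≤ μ (D k x) →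
      ν E ≤ β * ν (D k x)) :
    ν (superlevelSet μ ν D (D 0 x₀) (2 * K * t)) ≤ β * ν (superlevelSet μ ν D (D 0 x₀) t) := by
  set Ω := superlevelSet μ ν D (D 0 x₀) t
  set Ω' := superlevelSet μ ν D (D 0 x₀) (2 * K * t)
  have htle : t ≤ 2 * K * t :=
    le_mul_of_one_le_left' (one_le_two.trans (le_mul_of_one_le_right' hK1))
  have hsub : Ω' ⊆ Ω := by
    rintro x ⟨hx, k, hk⟩
    exact ⟨hx, k, (mul_le_mul_left htle _).trans_lt hk⟩
  have hΩ'm : MeasurableSet Ω' := hD.measurableSet_superlevelSet x₀ _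
  have hK0 : K ≠ 0 := (zero_lt_one.trans_le hK1).ne'
  have hblock : ∀ x ∈ Ω, ν (D (stoppingTime μ ν D t x) x) ≤
      t * K * μ (D (stoppingTime μ ν D t x) x) := by
    intro x hx
    rcases hk : stoppingTime μ ν D t x with _ | k
    · have h := lt_stoppingTime hx
      rw [hk, hD.eq_of_mem 0 x₀ x hx.1] at h
      exact absurd htop (not_le.2 h)
    · have h : ν (D k x) ≤ t * μ (D k x) := by
        by_contra! hlt
        have : stoppingTime μ ν D t x ≤ k := Nat.sInf_le hlt
        omega
      calc ν (D (k + 1) x) ≤ ν (D k x) := measure_mono (hD.succ_subset k x)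
        _ ≤ t * μ (D k x) := h
        _ ≤ t * (K * μ (D (k + 1) x)) := by gcongr; exact hdoubling k x hx.1
        _ = _ := by ring
  have hhalf : ∀ x ∈ Ω, 2 * μ (Ω' ∩ D (stoppingTime μ ν D t x) x) ≤
      μ (D (stoppingTime μ ν D t x) x) := by
    intro x hx
    set S := D (stoppingTime μ ν D t x) x with hS
    have hSm : MeasurableSet S := hD.measurableSet _ _
    have h1 : ((2 * K * t) • μ) (S ∩ Ω') ≤ ν (S ∩ Ω') := by
      refine hD.measure_inter_superlevelSet_le hSm hSm fun y hy => ?_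
      set S' := D (stoppingTime μ ν D (2 * K * t) y) y with hS'
      rcases (S ∩ S').eq_empty_or_nonempty with he | ⟨z, hz, hz'⟩
      · simp [he]
      · have hle : stoppingTime μ ν D t y ≤ stoppingTime μ ν D (2 * K * t) y :=
          Nat.sInf_le ((mul_le_mul_left htle _).trans_lt (lt_stoppingTime hy))
        have hzy : z ∈ D (stoppingTime μ ν D t y) y := hD.antitone y hle hz'
        have h2 : D (stoppingTime μ ν D t y) y = S := by
          rw [← hD.eq_of_mem_of_le le_rfl hzy, ← hD.stoppingTime_eq_of_mem (hsub hy) hzy,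
            hD.stoppingTime_eq_of_mem hx hz]
          exact hD.eq_of_mem_of_le le_rfl hz
        have h3 : S' ⊆ S := h2 ▸ hD.antitone y hle
        rw [Set.inter_eq_right.2 h3, Measure.smul_apply, smul_eq_mul]
        exact (lt_stoppingTime hy).le
    have h2 : (t * K) * (2 * μ (Ω' ∩ S)) ≤ (t * K) * μ S :=
      calc (t * K) * (2 * μ (Ω' ∩ S)) = ((2 * K * t) • μ) (S ∩ Ω') := by
            rw [Measure.smul_apply, smul_eq_mul, Set.inter_comm]; ring
        _ ≤ ν S := h1.trans (measure_mono Set.inter_subset_left)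
        _ ≤ _ := hblock x hx
    exact (ENNReal.mul_le_mul_iff_right (mul_ne_zero ht0 hK0) (ENNReal.mul_ne_top htt hKt)).1 h2
  have h := hD.measure_inter_superlevelSet_le (μ := μ) (ν := ν) (μ' := ν) (ν' := β • ν) (x₀ := x₀)
    (t := t) hΩ'm MeasurableSet.univ fun x hx => by
      rw [Set.univ_inter, Measure.smul_apply, smul_eq_mul]
      exact hβ _ x hx.1 _ Set.inter_subset_right (hΩ'm.inter (hD.measurableSet _ _)) (hhalf x hx)
  rwa [Set.inter_eq_left.2 hsub, Set.univ_inter, Measure.smul_apply, smul_eq_mul] at h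

lemma measure_superlevelSet_pow_mul_le (hD : IsNestedPartition D) {x₀ : X} {t K β : ℝ≥0∞}
    (ht0 : t ≠ 0) (htt : t ≠ ∞) (hK1 : 1 ≤ K) (hKt : K ≠ ∞)
    (htop : ν (D 0 x₀) ≤ t * μ (D 0 x₀))
    (hdoubling : ∀ k, ∀ x ∈ D 0 x₀, μ (D k x) ≤ K * μ (D (k + 1) x))
    (hβ : ∀ k, ∀ x ∈ D 0 x₀, ∀ E ⊆ D k x, MeasurableSet E → 2 * μ E ≤ μ (D k x) →
      ν E ≤ β * ν (D k x)) (j : ℕ) :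
    ν (superlevelSet μ ν D (D 0 x₀) ((2 * K) ^ j * t)) ≤ β ^ j * ν (D 0 x₀) := by
  have h2K : 1 ≤ 2 * K := one_le_two.trans (le_mul_of_one_le_right' hK1)
  induction j with
  | zero =>
    simp only [pow_zero, one_mul]
    exact measure_mono fun x hx => hx.1
  | succ j ih =>
    have h1 : 1 ≤ (2 * K) ^ j := one_le_pow_of_one_le' h2K j
    have h2 : (2 * K) ^ j ≠ ∞ := ENNReal.pow_ne_top (ENNReal.mul_ne_top (by simp) hKt)
    have h := hD.measure_superlevelSet_mul_le (t := (2 * K) ^ j * t)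
      (mul_ne_zero (zero_lt_one.trans_le h1).ne' ht0) (ENNReal.mul_ne_top h2 htt) hK1 hKt
      (htop.trans (mul_le_mul_left (le_mul_of_one_le_left' h1) _)) hdoubling hβ
    rw [← mul_assoc, ← pow_succ'] at h
    refine h.trans ?_
    rw [pow_succ', mul_assoc]
    gcongr

end IsNestedPartition

/-- Lebesgue differentiation along closed balls (which need not be centred). -/
lemma ae_tendsto_lintegral_closedBall_div {n : ℕ} {G : (Fin n → ℝ) → ℝ≥0∞} (hG : Measurable G)
    (hGt : ∫⁻ x, G x ≠ ∞) :
    ∀ᵐ x, ∀ (c : ℕ → Fin n → ℝ) (r : ℕ → ℝ),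
      Filter.Tendsto r Filter.atTop (nhdsWithin 0 (Set.Ioi 0)) →
      (∀ j, x ∈ Metric.closedBall (c j) (r j)) →
      Filter.Tendsto (fun j => (∫⁻ y in Metric.closedBall (c j) (r j), G y) /
        volume (Metric.closedBall (c j) (r j))) Filter.atTop (nhds (G x)) := by
  filter_upwards [(IsUnifLocDoublingMeasure.vitaliFamily (volume : Measure (Fin n → ℝ)) 1
    ).ae_tendsto_lintegral_div hG.aemeasurable hGt] with x hx c r hr hmem
  exact hx.comp (IsUnifLocDoublingMeasure.tendsto_closedBall_filterAt _ c r hr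
    (Filter.Eventually.of_forall fun j => by simpa using hmem j))

/-- The half-open dyadic cube of generation `k` containing `x`, relative to the cube with lower
corner `a` and side length `l`. -/
def dyadicCube {n : ℕ} (a : Fin n → ℝ) (l : ℝ) (k : ℕ) (x : Fin n → ℝ) : Set (Fin n → ℝ) :=
  {y | ∀ i, ⌊2 ^ k * ((y i - a i) / l)⌋ = ⌊2 ^ k * ((x i - a i) / l)⌋}

/-- The lower corner of `dyadicCube a l k x`. -/
noncomputable def dyadicCorner {n : ℕ} (a : Fin n → ℝ) (l : ℝ) (k : ℕ) (x : Fin n → ℝ) :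
    Fin n → ℝ :=
  fun i => a i + ⌊2 ^ k * ((x i - a i) / l)⌋ * (l / 2 ^ k)

section DyadicCube

variable {n : ℕ} (a : Fin n → ℝ) {l : ℝ}

lemma dyadicCube_eq_pi_Ico (hl : 0 < l) (k : ℕ) (x : Fin n → ℝ) :
    dyadicCube a l k x = Set.univ.pi fun i =>
      Set.Ico (dyadicCorner a l k x i) (dyadicCorner a l k x i + l / 2 ^ k) := by
  ext y
  have h2 : (0 : ℝ) < l / 2 ^ k := by positivity
  simp only [dyadicCube, Set.mem_ofPred_eq, Set.mem_univ_pi, Set.mem_Ico, dyadicCorner]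
  refine forall_congr' fun i => ?_
  have h3 : 2 ^ k * ((y i - a i) / l) = (y i - a i) / (l / 2 ^ k) := by field_simp
  rw [Int.floor_eq_iff, h3, le_div_iff₀ h2, div_lt_iff₀ h2]
  constructor <;> rintro ⟨h4, h5⟩ <;> constructor <;> linarith

lemma isNestedPartition_dyadicCube (hl : 0 < l) : IsNestedPartition (dyadicCube a l) where
  mem_self k x := fun _ => rfl
  eq_of_mem k x y hy := by
    ext z
    simp only [dyadicCube, Set.mem_ofPred_eq] at hy ⊢
    exact forall_congr' fun i => by rw [hy i]
  succ_subset k x := by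
    intro y hy i
    have key : ∀ s : ℝ, ⌊2 ^ k * s⌋ = ⌊2 ^ (k + 1) * s⌋ / (2 : ℕ) := by
      intro s
      rw [← Int.floor_div_natCast]
      congr 1
      push_cast
      ring
    rw [key, key, hy i]
  measurableSet k x := by
    rw [dyadicCube_eq_pi_Ico a hl]
    exact MeasurableSet.univ_pi fun _ => measurableSet_Ico
  countable k := by
    have : Set.range (dyadicCube a l k) ⊆
        Set.range fun m : Fin n → ℤ => {y | ∀ i, ⌊2 ^ k * ((y i - a i) / l)⌋ = m i} := by
      rintro _ ⟨x, rfl⟩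
      exact ⟨_, rfl⟩
    exact (Set.countable_range _).mono this

lemma dyadicCube_zero_self (hl : 0 < l) :
    dyadicCube a l 0 a = Set.univ.pi fun i => Set.Ico (a i) (a i + l) := by
  rw [dyadicCube_eq_pi_Ico a hl]
  simp [dyadicCorner]

lemma volume_dyadicCube (hl : 0 < l) (k : ℕ) (x : Fin n → ℝ) :
    volume (dyadicCube a l k x) = ENNReal.ofReal (l / 2 ^ k) ^ n := by
  rw [dyadicCube_eq_pi_Ico a hl, Real.volume_pi_Ico]
  simp

lemma volume_dyadicCube_le (hl : 0 < l) (k : ℕ) (x : Fin n → ℝ) :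
    volume (dyadicCube a l k x) ≤ 2 ^ n * volume (dyadicCube a l (k + 1) x) := by
  rw [volume_dyadicCube a hl, volume_dyadicCube a hl, ← mul_pow]
  refine pow_le_pow_left₀ zero_le ?_ n
  rw [← ENNReal.ofReal_ofNat 2, ← ENNReal.ofReal_mul (by norm_num)]
  refine ENNReal.ofReal_le_ofReal (le_of_eq ?_)
  rw [pow_succ]; field_simp

/-- The closure of `dyadicCube a l k x`, as a ball of the supremum metric. -/
noncomputable def closedDyadicCube {n : ℕ} (a : Fin n → ℝ) (l : ℝ) (k : ℕ) (x : Fin n → ℝ) :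
    Set (Fin n → ℝ) :=
  Metric.closedBall (fun i => dyadicCorner a l k x i + l / 2 ^ k / 2) (l / 2 ^ k / 2)

lemma closedDyadicCube_eq_pi_Icc (hl : 0 < l) (k : ℕ) (x : Fin n → ℝ) :
    closedDyadicCube a l k x = Set.univ.pi fun i =>
      Set.Icc (dyadicCorner a l k x i) (dyadicCorner a l k x i + l / 2 ^ k) := by
  rw [closedDyadicCube, closedBall_pi _ (by positivity)]
  congr 1
  ext1 i
  rw [Real.closedBall_eq_Icc]
  congr 1 <;> ring

lemma isCube_closedDyadicCube (hl : 0 < l) (k : ℕ) (x : Fin n → ℝ) :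
    IsCube (closedDyadicCube a l k x) :=
  ⟨_, l / 2 ^ k, by positivity, closedDyadicCube_eq_pi_Icc a hl k x⟩

lemma dyadicCube_ae_eq (hl : 0 < l) (k : ℕ) (x : Fin n → ℝ) :
    dyadicCube a l k x =ᵐ[volume] closedDyadicCube a l k x := by
  rw [dyadicCube_eq_pi_Ico a hl, closedDyadicCube_eq_pi_Icc a hl, Set.pi_univ_Icc]
  exact Measure.univ_pi_Ico_ae_eq_Icc

lemma dyadicCube_subset_closed (hl : 0 < l) (k : ℕ) (x : Fin n → ℝ) :
    dyadicCube a l k x ⊆ closedDyadicCube a l k x := by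
  rw [dyadicCube_eq_pi_Ico a hl, closedDyadicCube_eq_pi_Icc a hl]
  exact Set.pi_mono fun i _ => Set.Ico_subset_Icc_self

lemma closedDyadicCube_subset (hl : 0 < l) (k : ℕ) {x : Fin n → ℝ}
    (hx : x ∈ dyadicCube a l 0 a) :
    closedDyadicCube a l k x ⊆ Set.univ.pi fun i => Set.Icc (a i) (a i + l) := by
  have hD := isNestedPartition_dyadicCube a hl
  have h1 : dyadicCube a l k x ⊆ Set.univ.pi fun i => Set.Icc (a i) (a i + l) := by
    refine (hD.antitone x (Nat.zero_le k)).trans ?_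
    change dyadicCube a l 0 x ⊆ _
    rw [hD.eq_of_mem 0 a x hx, dyadicCube_zero_self a hl]
    exact Set.pi_mono fun i _ => Set.Ico_subset_Icc_self
  have h2 : closedDyadicCube a l k x = closure (dyadicCube a l k x) := by
    rw [dyadicCube_eq_pi_Ico a hl, closedDyadicCube_eq_pi_Icc a hl, closure_pi_set]
    congr 1
    ext1 i
    rw [closure_Ico]
    have : 0 < l / 2 ^ k := by positivity
    linarith
  rw [h2]
  exact closure_minimal h1 (isClosed_set_pi fun _ _ => isClosed_Icc)

end DyadicCube

/-- Almost every point at which the density `G` exceeds `t` lies in a dyadic cube on which the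
average of `G` exceeds `t`. -/
lemma ae_mem_superlevelSet_of_lt {n : ℕ} (a : Fin n → ℝ) {l : ℝ} (hl : 0 < l)
    {G : (Fin n → ℝ) → ℝ≥0∞} (hG : Measurable G) (hGt : ∫⁻ x, G x ≠ ∞) :
    ∀ᵐ x, x ∈ dyadicCube a l 0 a → ∀ t < G x,
      x ∈ superlevelSet volume (volume.withDensity G) (dyadicCube a l) (dyadicCube a l 0 a) t := by
  filter_upwards [ae_tendsto_lintegral_closedBall_div hG hGt] with x hx hx0 t ht
  refine ⟨hx0, ?_⟩
  have hr : Filter.Tendsto (fun k : ℕ => l / 2 ^ k / 2) Filter.atTop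
      (nhdsWithin 0 (Set.Ioi 0)) := by
    refine tendsto_nhdsWithin_iff.2 ⟨?_, Filter.Eventually.of_forall fun k => ?_⟩
    · have h := (tendsto_pow_atTop_nhds_zero_of_lt_one (r := (1 / 2 : ℝ)) (by norm_num)
        (by norm_num)).const_mul (l / 2)
      rw [mul_zero] at h
      refine h.congr fun k => ?_
      rw [div_pow, one_pow]; ring
    · exact Set.mem_Ioi.2 (by positivity)
  have h := hx _ _ hr fun k => dyadicCube_subset_closed a hl k x
    ((isNestedPartition_dyadicCube a hl).mem_self k x)
  obtain ⟨k, hk⟩ := (h.eventually (lt_mem_nhds ht)).exists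
  refine ⟨k, ?_⟩
  have hc := isCube_closedDyadicCube a hl k x
  rw [withDensity_apply _ ((isNestedPartition_dyadicCube a hl).measurableSet k x),
    measure_congr (dyadicCube_ae_eq a hl k x),
    setLIntegral_congr (dyadicCube_ae_eq a hl k x)]
  exact (ENNReal.lt_div_iff_mul_lt (Or.inl hc.volume_ne_zero) (Or.inl hc.volume_ne_top)).1 hk

lemma exists_rpow_mul_lt_one {Λ : ℝ} (hΛ : 0 < Λ) {β : ℝ≥0∞} (hβ : β < 1) :
    ∃ ε : ℝ, 0 < ε ∧ ENNReal.ofReal Λ ^ ε * β < 1 := by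
  have h1 : Filter.Tendsto (fun ε : ℝ => ENNReal.ofReal (Λ ^ ε) * β)
      (nhdsWithin 0 (Set.Ioi 0)) (nhds (ENNReal.ofReal (Λ ^ (0 : ℝ)) * β)) := by
    refine ENNReal.Tendsto.mul_const ?_ (Or.inr (ne_top_of_lt hβ))
    exact ENNReal.tendsto_ofReal
      ((Real.continuousAt_const_rpow hΛ.ne').tendsto.mono_left nhdsWithin_le_nhds)
  have h2 : ENNReal.ofReal (Λ ^ (0 : ℝ)) * β < 1 := by simpa using hβ
  obtain ⟨ε, h3, h4⟩ := ((h1.eventually (gt_mem_nhds h2)).and self_mem_nhdsWithin).exists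
  exact ⟨ε, h4, by rwa [ENNReal.ofReal_rpow_of_pos hΛ]⟩

/-- Self-improvement of integrability for `A_p` weights on a cube. -/
lemma MemApGT1.exists_lintegral_rpow_ne_top {n : ℕ} {Q : Set (Fin n → ℝ)} (hQ : IsCube Q) {p : ℝ}
    (hp : 1 < p) {w : (Fin n → ℝ) → ℝ} (hw : MemApGT1 Q p w) :
    ∃ ε : ℝ, 0 < ε ∧ ∫⁻ x in Q, ENNReal.ofReal (w x) ^ (1 + ε) ≠ ∞ := by
  obtain ⟨β, hβ1, hβ⟩ := hw.exists_setLIntegral_le hp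
  have hQm := hQ.measurableSet
  have hwQ : ∫⁻ x in Q, ENNReal.ofReal (w x) ≠ ∞ :=
    (hw.1.locInt Q hQ subset_rfl).lintegral_lt_top.ne
  have hwm := hw.1.measurable
  obtain ⟨a, l, hl, hQdef⟩ := hQ
  have hD := isNestedPartition_dyadicCube a hl
  set G : (Fin n → ℝ) → ℝ≥0∞ := Q.indicator fun x => ENNReal.ofReal (w x) with hGdef
  have hG : Measurable G := hwm.ennreal_ofReal.indicator hQm
  have hGint : ∫⁻ x, G x = ∫⁻ x in Q, ENNReal.ofReal (w x) := lintegral_indicator hQm _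
  have hGt : ∫⁻ x, G x ≠ ∞ := hGint ▸ hwQ
  set ν : Measure (Fin n → ℝ) := volume.withDensity G with hν
  set D := dyadicCube a l with hDdef
  have hclosed : ∀ k, ∀ x ∈ D 0 a, closedDyadicCube a l k x ⊆ Q := fun k x hx => by
    rw [hQdef]; exact closedDyadicCube_subset a hl k hx
  have hνE : ∀ E ⊆ Q, MeasurableSet E → ν E = ∫⁻ x in E, ENNReal.ofReal (w x) := by
    intro E hE hEm
    rw [hν, withDensity_apply _ hEm]
    exact setLIntegral_congr_fun hEm fun x hx => Set.indicator_of_mem (hE hx) _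
  have hD0Q : D 0 a ⊆ Q :=
    (dyadicCube_subset_closed a hl 0 a).trans (hclosed 0 a (hD.mem_self 0 a))
  have hνac : ν ≪ volume := withDensity_absolutelyContinuous _ _
  have hQae : D 0 a =ᵐ[volume] Q := by
    refine (dyadicCube_ae_eq a hl 0 a).trans (Filter.EventuallyEq.of_eq ?_)
    rw [closedDyadicCube_eq_pi_Icc a hl, hQdef]
    congr 1
    ext1 i
    simp [dyadicCorner]
  have hνuniv : ν Set.univ = ν (D 0 a) := by
    rw [measure_congr (hνac.ae_eq hQae), hνE Q subset_rfl hQm, hν,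
      withDensity_apply _ MeasurableSet.univ, setLIntegral_univ, hGint]
  have hhalf : ∀ k, ∀ x ∈ D 0 a, ∀ E ⊆ D k x, MeasurableSet E →
      2 * volume E ≤ volume (D k x) → ν E ≤ β * ν (D k x) := by
    intro k x hx E hE hEm hE2
    have hE' : E ⊆ closedDyadicCube a l k x := hE.trans (dyadicCube_subset_closed a hl k x)
    have hcube := isCube_closedDyadicCube a hl k x
    rw [measure_congr (dyadicCube_ae_eq a hl k x)] at hE2
    rw [measure_congr (hνac.ae_eq (dyadicCube_ae_eq a hl k x)),
      hνE _ (hclosed k x hx) hcube.measurableSet, hνE E (hE'.trans (hclosed k x hx)) hEm]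
    exact hβ _ hcube (hclosed k x hx) E hE' hEm hE2
  have hvol0 : volume (D 0 a) ≠ 0 := by
    rw [measure_congr (dyadicCube_ae_eq a hl 0 a)]
    exact (isCube_closedDyadicCube a hl 0 a).volume_ne_zero
  have hvolt : volume (D 0 a) ≠ ∞ := by
    rw [measure_congr (dyadicCube_ae_eq a hl 0 a)]
    exact (isCube_closedDyadicCube a hl 0 a).volume_ne_top
  have hνt : ν (D 0 a) ≠ ∞ := by
    rw [hνE _ hD0Q (hD.measurableSet 0 a)]
    exact ne_top_of_le_ne_top hwQ (lintegral_mono_set hD0Q)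
  set t : ℝ≥0∞ := ν (D 0 a) / volume (D 0 a) + 1 with ht
  have ht0 : t ≠ 0 := by simp [ht]
  have htt : t ≠ ∞ := by
    rw [ht]; exact ENNReal.add_ne_top.2 ⟨(ENNReal.div_lt_top hνt hvol0).ne, by simp⟩
  have htop : ν (D 0 a) ≤ t * volume (D 0 a) := by
    rw [ht, add_mul, ENNReal.div_mul_cancel hvol0 hvolt]
    exact le_self_add
  have hdecay := hD.measure_superlevelSet_pow_mul_le (μ := volume) (ν := ν) (x₀ := a)
    (K := 2 ^ n) ht0 htt (one_le_pow_of_one_le' one_le_two n) (by simp) htop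
    (fun k x _ => volume_dyadicCube_le a hl k x) hhalf
  have hΛ : (2 * 2 ^ n : ℝ≥0∞) = ENNReal.ofReal (2 * 2 ^ n) := by
    rw [ENNReal.ofReal_mul (by norm_num), ENNReal.ofReal_pow (by norm_num)]
    simp
  obtain ⟨ε, hε, hεβ⟩ := exists_rpow_mul_lt_one (Λ := 2 * 2 ^ n) (by positivity) hβ1
  rw [← hΛ] at hεβ
  have hlevel : ∀ j : ℕ, ν {x | (2 * 2 ^ n) ^ j * t < G x} ≤ β ^ j * ν (D 0 a) := by
    intro j
    refine le_trans (measure_mono_ae (hνac.ae_le ?_)) (hdecay j)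
    filter_upwards [ae_mem_superlevelSet_of_lt a hl hG hGt, hQae.mem_iff] with x hx hxQ hlt
    refine hx (hxQ.2 ?_) _ hlt
    by_contra hxn
    have hlt' : (2 * 2 ^ n) ^ j * t < G x := hlt
    rw [hGdef, Set.indicator_of_notMem hxn] at hlt'
    simp at hlt'
  have hmain := lintegral_rpow_le_of_measure_pow_lt_le (ρ := ν) hG hε (Λ := 2 * 2 ^ n) (β := β)
    (t := t) (M := ν (D 0 a))
    (lt_of_lt_of_le ENNReal.one_lt_two
      (le_mul_of_one_le_right' (one_le_pow_of_one_le' one_le_two n)))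
    (by finiteness) ht0 htt hνuniv.le hlevel
  refine ⟨ε, hε, ?_⟩
  have hEq : ∫⁻ x in Q, ENNReal.ofReal (w x) ^ (1 + ε) = ∫⁻ x, G x ^ ε ∂ν := by
    rw [hν, lintegral_withDensity_eq_lintegral_mul _ hG (by fun_prop), ← lintegral_indicator hQm]
    refine lintegral_congr fun x => ?_
    by_cases hx : x ∈ Q
    · simp only [hGdef, Pi.mul_apply, Set.indicator_of_mem hx]
      rw [ENNReal.rpow_add_of_nonneg _ _ zero_le_one hε.le, ENNReal.rpow_one]
    · simp only [hGdef, Pi.mul_apply, Set.indicator_of_notMem hx, zero_mul]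
  rw [hEq]
  refine ne_top_of_le_ne_top ?_ hmain
  have h1 : (1 - (2 * 2 ^ n) ^ ε * β)⁻¹ ≠ ∞ :=
    ENNReal.inv_ne_top.2 (tsub_pos_of_lt hεβ).ne'
  have h2 : (2 * 2 ^ n : ℝ≥0∞) ^ ε ≠ ∞ :=
    ENNReal.rpow_ne_top_of_nonneg hε.le (by finiteness)
  have h3 : t ^ ε ≠ ∞ := ENNReal.rpow_ne_top_of_nonneg hε.le htt
  exact ENNReal.mul_ne_top (ENNReal.mul_ne_top
    (ENNReal.add_ne_top.2 ⟨by simp, ENNReal.mul_ne_top h2 h1⟩) h3) hνt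

/-- The average of `G` over the closed ball of radius `2 ^ k` centred at `x`. -/
noncomputable def ballAverage {n : ℕ} (G : (Fin n → ℝ) → ℝ≥0∞) (k : ℤ) (x : Fin n → ℝ) : ℝ≥0∞ :=
  (∫⁻ y in Metric.closedBall x (2 ^ k), G y) / volume (Metric.closedBall x ((2 : ℝ) ^ k))

/-- The centred maximal function with dyadic radii. -/
noncomputable def centredMaximal {n : ℕ} (G : (Fin n → ℝ) → ℝ≥0∞) (x : Fin n → ℝ) : ℝ≥0∞ :=
  ⨆ k : ℤ, ballAverage G k x

section CentredMaximal

variable {n : ℕ} {G : (Fin n → ℝ) → ℝ≥0∞}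

lemma volume_closedBall_two_zpow_ne_zero (k : ℤ) (x : Fin n → ℝ) :
    volume (Metric.closedBall x ((2 : ℝ) ^ k)) ≠ 0 :=
  (Metric.measure_closedBall_pos volume x (by positivity)).ne'

lemma volume_closedBall_mul {c r : ℝ} (hc : 0 ≤ c) (hr : 0 ≤ r) (x y : Fin n → ℝ) :
    volume (Metric.closedBall x (c * r)) =
      ENNReal.ofReal c ^ n * volume (Metric.closedBall y r) := by
  rw [Real.volume_pi_closedBall _ (by positivity), Real.volume_pi_closedBall _ hr,
    ← ENNReal.ofReal_pow hc, ← ENNReal.ofReal_mul (by positivity)]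
  congr 1
  rw [Fintype.card_fin]; ring

lemma volume_closedBall_two_zpow_succ (k : ℤ) (x y : Fin n → ℝ) :
    volume (Metric.closedBall x ((2 : ℝ) ^ (k + 1))) =
      2 ^ n * volume (Metric.closedBall y ((2 : ℝ) ^ k)) := by
  rw [zpow_add_one₀ (by norm_num), mul_comm,
    volume_closedBall_mul (by norm_num) (by positivity) x y]
  simp

lemma measurable_centredMaximal (hG : Measurable G) : Measurable (centredMaximal G) := by
  refine Measurable.iSup fun k => ?_
  have h1 : Measurable fun x : Fin n → ℝ => ∫⁻ y in Metric.closedBall x ((2 : ℝ) ^ k), G y := by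
    have h2 : MeasurableSet {q : (Fin n → ℝ) × (Fin n → ℝ) | dist q.2 q.1 ≤ (2 : ℝ) ^ k} :=
      measurableSet_le (by fun_prop) (by fun_prop)
    have h3 := ((hG.comp measurable_snd).indicator h2).lintegral_prod_right'
      (ν := (volume : Measure (Fin n → ℝ)))
    convert h3 using 1
    ext x
    rw [← lintegral_indicator Metric.isClosed_closedBall.measurableSet]
    rfl
  have h4 : ballAverage G k = fun x => (∫⁻ y in Metric.closedBall x ((2 : ℝ) ^ k), G y) /
      volume (Metric.closedBall (0 : Fin n → ℝ) ((2 : ℝ) ^ k)) := by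
    ext x
    rw [ballAverage, Real.volume_pi_closedBall _ (by positivity),
      Real.volume_pi_closedBall _ (by positivity)]
  rw [h4]
  exact h1.div_const _

/-- Weak type `(1, 1)` bound for the truncated maximal function. -/
lemma mul_volume_lt_ballAverage_le (m : ℤ) (s : ℝ≥0∞) :
    s * volume {x | ∃ k ≤ m, s < ballAverage G k x} ≤ 4 ^ n * ∫⁻ x, G x := by
  set E := {x | ∃ k ≤ m, s < ballAverage G k x} with hE
  have hex : ∀ x : Fin n → ℝ, ∃ k : ℤ, x ∈ E → k ≤ m ∧ s < ballAverage G k x := by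
    intro x
    by_cases hx : x ∈ E
    · obtain ⟨k, hk⟩ := hx
      exact ⟨k, fun _ => hk⟩
    · exact ⟨0, fun h => absurd h hx⟩
  choose k hk using hex
  obtain ⟨u, huE, hdisj, hcov⟩ := Vitali.exists_disjoint_subfamily_covering_enlargement_closedBall
    E (fun x => x) (fun x => (2 : ℝ) ^ k x) (2 ^ m)
    (fun x hx => zpow_le_zpow_right₀ (by norm_num) (hk x hx).1) 4 (by norm_num)
  have hcount : u.Countable := hdisj.countable_of_nonempty_interior fun x _ => by
    refine Set.Nonempty.mono Metric.ball_subset_interior_closedBall ?_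
    exact Metric.nonempty_ball.2 (by positivity)
  have hsub : E ⊆ ⋃ x ∈ u, Metric.closedBall x (4 * (2 : ℝ) ^ k x) := by
    intro x hx
    obtain ⟨b, hb, hxb⟩ := hcov x hx
    exact Set.mem_biUnion hb (hxb (Metric.mem_closedBall_self (by positivity)))
  calc s * volume E ≤ s * ∑' x : u,
          volume (Metric.closedBall (x : Fin n → ℝ) (4 * (2 : ℝ) ^ k x)) := by
        gcongr
        exact (measure_mono hsub).trans (measure_biUnion_le _ hcount _)
    _ = ∑' x : u, 4 ^ n * (s * volume (Metric.closedBall (x : Fin n → ℝ) ((2 : ℝ) ^ k x))) := by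
        rw [← ENNReal.tsum_mul_left]
        congr 1
        ext x
        rw [volume_closedBall_mul (by norm_num) (by positivity) (x : Fin n → ℝ) x,
          ENNReal.ofReal_ofNat]
        ring
    _ ≤ ∑' x : u, 4 ^ n * ∫⁻ y in Metric.closedBall (x : Fin n → ℝ) ((2 : ℝ) ^ k x), G y := by
        gcongr with x
        have h := (hk x (huE x.2)).2
        rw [ballAverage, ENNReal.lt_div_iff_mul_lt
          (Or.inl (volume_closedBall_two_zpow_ne_zero _ _))
          (Or.inl measure_closedBall_lt_top.ne)] at h
        exact h.le
    _ = 4 ^ n * ∫⁻ y in ⋃ x ∈ u, Metric.closedBall x ((2 : ℝ) ^ k x), G y := by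
        rw [ENNReal.tsum_mul_left, lintegral_biUnion hcount
          (fun _ _ => Metric.isClosed_closedBall.measurableSet) hdisj]
    _ ≤ _ := by gcongr; exact Measure.restrict_le_self

/-- Local bound for the maximal function: on a ball, its small powers average to at most the value
dictated by the averages over larger concentric balls. -/
lemma setLIntegral_centredMaximal_rpow_le (hG : Measurable G) {δ : ℝ} (hδ : 0 < δ)
    (x : Fin n → ℝ) (m : ℤ) {t : ℝ≥0∞} (ht0 : t ≠ 0) (htt : t ≠ ∞)
    (ht : ∀ k > m, 8 ^ n * ballAverage G k x ≤ t) :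
    ∫⁻ y in Metric.closedBall x (2 ^ m), centredMaximal G y ^ δ ≤
      (1 + 2 ^ δ * (1 - 2 ^ δ * 2⁻¹)⁻¹) * t ^ δ * volume (Metric.closedBall x ((2 : ℝ) ^ m)) := by
  refine lintegral_rpow_le_of_measure_pow_lt_le (measurable_centredMaximal hG) hδ
    ENNReal.one_lt_two (by simp) ht0 htt (by simp) fun j => ?_
  set s : ℝ≥0∞ := 2 ^ j * t with hs
  have hts : t ≤ s := le_mul_of_one_le_left' (one_le_pow_of_one_le' one_le_two j)
  set B := Metric.closedBall x ((2 : ℝ) ^ m)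
  set B₂ := Metric.closedBall x ((2 : ℝ) ^ (m + 1)) with hB₂
  have hB₂m : MeasurableSet B₂ := Metric.isClosed_closedBall.measurableSet
  have hBm : MeasurableSet B := Metric.isClosed_closedBall.measurableSet
  have hincl : {y | s < centredMaximal G y} ∩ B ⊆
      {y | ∃ k ≤ m, s < ballAverage (B₂.indicator G) k y} := by
    rintro y ⟨hy, hyB⟩
    obtain ⟨k, hk⟩ := lt_iSup_iff.1 (show s < ⨆ k, ballAverage G k y from hy)
    have hdist : dist y x ≤ 2 ^ m := hyB
    have hkm : k ≤ m := by
      by_contra! hlt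
      refine not_lt.2 ?_ hk
      have hsub : Metric.closedBall y ((2 : ℝ) ^ k) ⊆ Metric.closedBall x (2 ^ (k + 1)) := by
        refine Metric.closedBall_subset_closedBall' ?_
        have : (2 : ℝ) ^ m ≤ 2 ^ k := zpow_le_zpow_right₀ (by norm_num) hlt.le
        rw [zpow_add_one₀ (by norm_num)]
        linarith
      calc ballAverage G k y ≤ 2 ^ n * ballAverage G (k + 1) x := by
            rw [ballAverage, ballAverage, volume_closedBall_two_zpow_succ k x y]
            rw [ENNReal.div_eq_inv_mul, ENNReal.div_eq_inv_mul,
              ENNReal.mul_inv (by simp) (by simp), ← mul_assoc, ← mul_assoc,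
              ENNReal.mul_inv_cancel (by simp) (by simp), one_mul]
            gcongr
        _ ≤ 8 ^ n * ballAverage G (k + 1) x := by gcongr; norm_num
        _ ≤ t := ht _ (by omega)
        _ ≤ s := hts
    refine ⟨k, hkm, ?_⟩
    have hsub : Metric.closedBall y ((2 : ℝ) ^ k) ⊆ B₂ := by
      refine Metric.closedBall_subset_closedBall' ?_
      have : (2 : ℝ) ^ k ≤ 2 ^ m := zpow_le_zpow_right₀ (by norm_num) hkm
      rw [zpow_add_one₀ (by norm_num)]
      linarith
    have heq : ballAverage (B₂.indicator G) k y = ballAverage G k y := by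
      rw [ballAverage, ballAverage]
      congr 1
      exact setLIntegral_congr_fun Metric.isClosed_closedBall.measurableSet
        fun z hz => Set.indicator_of_mem (hsub hz) _
    exact heq ▸ hk
  have hweak := mul_volume_lt_ballAverage_le (G := B₂.indicator G) m s
  rw [lintegral_indicator hB₂m] at hweak
  have hint : ∫⁻ y in B₂, G y = 2 ^ n * volume B * ballAverage G (m + 1) x := by
    rw [ballAverage, ← volume_closedBall_two_zpow_succ m x x, ENNReal.mul_div_cancel
      (volume_closedBall_two_zpow_ne_zero _ _) measure_closedBall_lt_top.ne]
  rw [Measure.restrict_apply' hBm]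
  refine (measure_mono hincl).trans ?_
  set V := volume {y | ∃ k ≤ m, s < ballAverage (B₂.indicator G) k y}
  have h1 : t * (2 ^ j * V) ≤ t * volume B :=
    calc t * (2 ^ j * V) = s * V := by rw [hs]; ring
      _ ≤ 4 ^ n * (2 ^ n * volume B * ballAverage G (m + 1) x) := by rw [← hint]; exact hweak
      _ = volume B * (8 ^ n * ballAverage G (m + 1) x) := by
        rw [show (8 : ℝ≥0∞) = 4 * 2 by norm_num, mul_pow]; ring
      _ ≤ volume B * t := by gcongr; exact ht _ (by omega)
      _ = _ := mul_comm _ _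
  rw [ENNReal.mul_le_mul_iff_right ht0 htt] at h1
  rw [← ENNReal.inv_pow]
  rw [← ENNReal.mul_le_mul_iff_right (a := 2 ^ j) (by simp) (by finiteness), ← mul_assoc,
    ENNReal.mul_inv_cancel (by simp) (by finiteness), one_mul]
  exact h1

end CentredMaximal

/-- A cube with a marked point lies in a ball of comparable volume centred at that point. -/
lemma IsCube.exists_subset_closedBall {n : ℕ} {Q : Set (Fin n → ℝ)} (hQ : IsCube Q)
    {x : Fin n → ℝ} (hx : x ∈ Q) :
    ∃ m : ℤ, Q ⊆ Metric.closedBall x (2 ^ m) ∧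
      volume (Metric.closedBall x ((2 : ℝ) ^ m)) ≤ 4 ^ n * volume Q := by
  obtain ⟨c, s, hs, rfl⟩ := hQ
  obtain ⟨m, hm1, hm2⟩ := _root_.exists_mem_Ioc_zpow hs (one_lt_two : (1 : ℝ) < 2)
  refine ⟨m + 1, fun y hy => ?_, ?_⟩
  · rw [Metric.mem_closedBall, dist_pi_le_iff (by positivity)]
    intro i
    have h1 := hx i (Set.mem_univ i)
    have h2 := hy i (Set.mem_univ i)
    rw [Set.mem_Icc] at h1 h2
    rw [Real.dist_eq, abs_le]
    constructor <;> linarith [h1.1, h1.2, h2.1, h2.2]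
  · have h4 : (4 : ℝ≥0∞) = ENNReal.ofReal 4 := by simp
    rw [Real.volume_pi_closedBall _ (by positivity), volume_pi_pi]
    simp only [Real.volume_Icc, add_sub_cancel_left, Finset.prod_const, Finset.card_univ,
      Fintype.card_fin]
    rw [← ENNReal.ofReal_pow hs.le, h4, ← ENNReal.ofReal_pow (by norm_num),
      ← ENNReal.ofReal_mul (by positivity), ← mul_pow]
    refine ENNReal.ofReal_le_ofReal (pow_le_pow_left₀ (by positivity) ?_ n)
    rw [zpow_add_one₀ (by norm_num)]
    linarith

lemma one_add_two_rpow_mul_ne_top {δ : ℝ} (hδ1 : δ < 1) :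
    (1 + 2 ^ δ * (1 - 2 ^ δ * 2⁻¹)⁻¹ : ℝ≥0∞) ≠ ∞ := by
  have h1 : (2 : ℝ≥0∞) ^ δ < 2 := by
    simpa using ENNReal.rpow_lt_rpow_of_exponent_lt ENNReal.one_lt_two (by simp) hδ1
  have h2 : (2 : ℝ≥0∞) ^ δ * 2⁻¹ < 1 := by
    rw [← div_eq_mul_inv]
    exact ENNReal.div_lt_of_lt_mul (by simpa using h1)
  exact ENNReal.add_ne_top.2 ⟨by simp, ENNReal.mul_ne_top h1.ne_top
    (ENNReal.inv_ne_top.2 (tsub_pos_of_lt h2).ne')⟩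

lemma IsCube.setLIntegral_centredMaximal_rpow_ne_top {n : ℕ} {Q : Set (Fin n → ℝ)} (hQ : IsCube Q)
    {G : (Fin n → ℝ) → ℝ≥0∞} (hG : Measurable G) (hGt : ∫⁻ x, G x ≠ ∞) {δ : ℝ} (hδ : 0 < δ)
    (hδ1 : δ < 1) : ∫⁻ x in Q, centredMaximal G x ^ δ ≠ ∞ := by
  obtain ⟨x, hx⟩ := nonempty_of_measure_ne_zero hQ.volume_ne_zero
  obtain ⟨m, hm, -⟩ := hQ.exists_subset_closedBall hx
  have hV0 := volume_closedBall_two_zpow_ne_zero m x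
  set t : ℝ≥0∞ :=
    8 ^ n * ((∫⁻ y, G y) / volume (Metric.closedBall x ((2 : ℝ) ^ m))) + 1 with ht
  have htt : t ≠ ∞ := ENNReal.add_ne_top.2
    ⟨ENNReal.mul_ne_top (by finiteness) (ENNReal.div_lt_top hGt hV0).ne, by simp⟩
  refine ne_top_of_le_ne_top ?_ ((lintegral_mono_set hm).trans
    (setLIntegral_centredMaximal_rpow_le hG hδ x m (t := t) (by simp [ht]) htt fun k hk => ?_))
  · exact ENNReal.mul_ne_top (ENNReal.mul_ne_top (one_add_two_rpow_mul_ne_top hδ1)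
      (ENNReal.rpow_ne_top_of_nonneg hδ.le htt)) measure_closedBall_lt_top.ne
  · refine le_trans ?_ le_self_add
    unfold ballAverage
    gcongr
    · exact Measure.restrict_le_self
    · norm_num

/-- The Coifman–Rochberg construction: powers `δ < 1` of maximal functions are `A₁` weights. -/
lemma exists_memA1_majorant {n : ℕ} {Q : Set (Fin n → ℝ)} (hQ : IsCube Q)
    {G : (Fin n → ℝ) → ℝ≥0∞} (hG : Measurable G) (hGt : ∫⁻ x, G x ≠ ∞)
    (hG0 : ∀ᵐ x ∂volume.restrict Q, G x ≠ 0) {δ : ℝ} (hδ : 0 < δ) (hδ1 : δ < 1) :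
    ∃ v, MemA1 Q v ∧ ∀ᵐ x ∂volume.restrict Q, G x ^ δ ≤ ENNReal.ofReal (v x) := by
  have hMm := measurable_centredMaximal hG
  have hle : ∀ᵐ x ∂volume.restrict Q, G x ≤ centredMaximal G x := by
    refine ae_restrict_of_ae ?_
    filter_upwards [ae_tendsto_lintegral_closedBall_div hG hGt] with x hx
    have hr : Filter.Tendsto (fun k : ℕ => (2 : ℝ) ^ (-(k : ℤ))) Filter.atTop
        (nhdsWithin 0 (Set.Ioi 0)) := by
      refine tendsto_nhdsWithin_iff.2 ⟨?_, Filter.Eventually.of_forall fun k => ?_⟩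
      · refine (tendsto_pow_atTop_nhds_zero_of_lt_one (r := (1 / 2 : ℝ)) (by norm_num)
          (by norm_num)).congr fun k => ?_
        simp
      · exact Set.mem_Ioi.2 (by positivity)
    exact le_of_tendsto' (hx (fun _ => x) _ hr fun j => Metric.mem_closedBall_self (by positivity))
      fun j => le_iSup (fun k => ballAverage G k x) (-(j : ℤ))
  have hfin : ∀ᵐ x ∂volume.restrict Q, centredMaximal G x ≠ ∞ := by
    filter_upwards [ae_lt_top (hMm.pow_const δ)
      (hQ.setLIntegral_centredMaximal_rpow_ne_top hG hGt hδ hδ1)] with x hx htop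
    rw [htop, ENNReal.top_rpow_of_pos hδ] at hx
    exact lt_irrefl _ hx
  set v : (Fin n → ℝ) → ℝ := fun x => (centredMaximal G x ^ δ).toReal with hv
  have hv0 : ∀ x, 0 ≤ v x := fun x => ENNReal.toReal_nonneg
  have hvm : Measurable v := (hMm.pow_const δ).ennreal_toReal
  have hvle : ∀ x, ENNReal.ofReal |v x| ≤ centredMaximal G x ^ δ := fun x => by
    rw [abs_of_nonneg (hv0 x)]
    exact ENNReal.ofReal_toReal_le
  have hveq : ∀ x, centredMaximal G x ≠ ∞ → ENNReal.ofReal (v x) = centredMaximal G x ^ δ :=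
    fun x hx => ENNReal.ofReal_toReal (ENNReal.rpow_ne_top_of_nonneg hδ.le hx)
  set K : ℝ≥0∞ := (1 + 2 ^ δ * (1 - 2 ^ δ * 2⁻¹)⁻¹) * (8 ^ n) ^ δ * 4 ^ n with hK
  have hKt : K ≠ ∞ := ENNReal.mul_ne_top (ENNReal.mul_ne_top (one_add_two_rpow_mul_ne_top hδ1)
    (ENNReal.rpow_ne_top_of_nonneg hδ.le (by finiteness))) (by finiteness)
  refine ⟨v, ⟨⟨hvm, ?_, fun Q' hQ' _ => ?_⟩, K.toReal, ?_⟩, ?_⟩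
  · filter_upwards [hG0, hle, hfin] with x h0 h1 h2
    refine ENNReal.toReal_pos ?_ (ENNReal.rpow_ne_top_of_nonneg hδ.le h2)
    have h3 : centredMaximal G x ≠ 0 := fun h => h0 (le_zero_iff.1 (h ▸ h1))
    simp [ENNReal.rpow_eq_zero_iff, h3, h2]
  · refine ⟨hvm.aestronglyMeasurable, ?_⟩
    rw [hasFiniteIntegral_iff_norm]
    refine lt_of_le_of_lt (lintegral_mono fun x => hvle x)
      (hQ'.setLIntegral_centredMaximal_rpow_ne_top hG hGt hδ hδ1).lt_top
  · filter_upwards [hG0, hle, hfin] with x h0 h1 h2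
    have h3 : centredMaximal G x ≠ 0 := fun h => h0 (le_zero_iff.1 (h ▸ h1))
    rw [ENNReal.ofReal_mul ENNReal.toReal_nonneg, ENNReal.ofReal_toReal hKt, hveq x h2]
    refine iSup_le fun Q' => iSup_le fun hQ' => iSup_le fun _ => iSup_le fun hx => ?_
    obtain ⟨m, hm, hvol⟩ := hQ'.exists_subset_closedBall hx
    rw [ENNReal.inv_mul_le_iff hQ'.volume_ne_zero hQ'.volume_ne_top]
    calc ∫⁻ y in Q', ENNReal.ofReal |v y| ≤ ∫⁻ y in Q', centredMaximal G y ^ δ :=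
          lintegral_mono fun y => hvle y
      _ ≤ ∫⁻ y in Metric.closedBall x (2 ^ m), centredMaximal G y ^ δ := lintegral_mono_set hm
      _ ≤ _ := setLIntegral_centredMaximal_rpow_le hG hδ x m
          (t := 8 ^ n * centredMaximal G x) (mul_ne_zero (by simp) h3)
          (ENNReal.mul_ne_top (by finiteness) h2) fun k _ => by
            gcongr
            exact le_iSup (fun k => ballAverage G k x) k
      _ ≤ (1 + 2 ^ δ * (1 - 2 ^ δ * 2⁻¹)⁻¹) * (8 ^ n * centredMaximal G x) ^ δ *
          (4 ^ n * volume Q') := by gcongr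
      _ = _ := by
        rw [ENNReal.mul_rpow_of_nonneg _ _ hδ.le, hK]
        ring
  · filter_upwards [hle, hfin] with x h1 h2
    rw [hveq x h2]
    exact ENNReal.rpow_le_rpow h1 hδ.le

/-- On a cube, every `A_p` weight with `p > 1` is dominated by an `A₁` weight. -/
lemma MemApGT1.exists_memA1_majorant {n : ℕ} {Q : Set (Fin n → ℝ)} (hQ : IsCube Q) {p : ℝ}
    (hp : 1 < p) {w : (Fin n → ℝ) → ℝ} (hw : MemApGT1 Q p w) :
    ∃ v, MemA1 Q v ∧ ∀ᵐ x ∂volume.restrict Q, w x ≤ v x := by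
  obtain ⟨ε, hε, hint⟩ := hw.exists_lintegral_rpow_ne_top hQ hp
  have hQm := hQ.measurableSet
  have hwm := hw.1.measurable
  obtain ⟨v, hv, hwv⟩ := _root_.exists_memA1_majorant hQ
    (G := Q.indicator fun x => ENNReal.ofReal (w x) ^ (1 + ε))
    ((hwm.ennreal_ofReal.pow_const _).indicator hQm) (by rwa [lintegral_indicator hQm])
    (by
      filter_upwards [hw.1.pos, ae_restrict_mem hQm] with x hx hxQ
      rw [Set.indicator_of_mem hxQ]
      simp [ENNReal.rpow_eq_zero_iff, hx])
    (δ := (1 + ε)⁻¹) (by positivity) (inv_lt_one_of_one_lt₀ (by linarith))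
  refine ⟨v, hv, ?_⟩
  filter_upwards [hwv, ae_restrict_mem hQm, hv.1.pos] with x hx hxQ hvx
  rw [Set.indicator_of_mem hxQ, ENNReal.rpow_rpow_inv (by positivity)] at hx
  exact (ENNReal.ofReal_le_ofReal_iff hvx.le).1 hx

theorem stmt3 (n : ℕ) (Q : Set (Fin n → ℝ)) (hQ : IsCube Q) :
    {f : (Fin n → ℝ) → ℝ | HasApMajorant Q 1 f} =
      {f | HasAInfMajorant Q f} := by
  ext f
  constructor
  · rintro ⟨hf, w, hw, hfw⟩
    exact ⟨hf, w, ⟨1, le_rfl, hw⟩, hfw⟩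
  · rintro ⟨hf, w, ⟨p, -, ⟨rfl, hw⟩ | ⟨hp, hw⟩⟩, hfw⟩
    · exact ⟨hf, w, Or.inl ⟨rfl, hw⟩, hfw⟩
    · obtain ⟨v, hv, hwv⟩ := hw.exists_memA1_majorant hQ hp
      refine ⟨hf, v, Or.inl ⟨rfl, hv⟩, ?_⟩
      filter_upwards [hfw, hwv] with x h1 h2
      exact h1.trans h2
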